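/- Let 0 → L →(i)→ D →(p)→ E → 0 be a degreewise short exact sequence of ℤ-indexed cochain complexes of abelian groups, let φ : F → D be a chain map, and let k be an integer such that F^j = 0 for all j < k. Then the natural map H^k(cone(p∘φ : F → E)) → H^k(cone((i,φ) : L ⊕ F → D)) is an isomorphism of abelian groups. -/

import Mathlib

open Function

/-- Transport along an equality of indices, as an additive homomorphism. -/
def chom (T : ℤ → Type) [inst : ∀ n, AddCommGroup (T n)] {i j : ℤ} (h : i = j) :
    T i →+ T j := by subst h; exact AddMonoidHom.id _

@[simp] lemma chom_rfl (T : ℤ → Type) [∀ n, AddCommGroup (T n)] {i : ℤ} (x : T i) :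
    chom T rfl x = x := rfl

lemma chom_chom (T : ℤ → Type) [∀ n, AddCommGroup (T n)] {i j k : ℤ}
    (h : i = j) (h' : j = k) (x : T i) :
    chom T h' (chom T h x) = chom T (h.trans h') x := by subst h; subst h'; rfl

/-- A ℤ-indexed cochain complex of abelian groups. -/
structure CochainCpx : Type 1 where
  X : ℤ → Type
  grp : ∀ n, AddCommGroup (X n)
  d : ∀ n : ℤ, X n →+ X (n + 1)
  dsq : ∀ (n : ℤ) (x : X n), d (n + 1) (d n x) = 0

attribute [instance] CochainCpx.grp

lemma CochainCpx.d_chom (C : CochainCpx) {i j : ℤ} (h : i = j) (x : C.X i) :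
    C.d j (chom C.X h x) = chom C.X (by rw [h]) (C.d i x) := by subst h; rfl

/-- A chain map of cochain complexes. -/
structure ChainMap (C D : CochainCpx) where
  f : ∀ n : ℤ, C.X n →+ D.X n
  comm : ∀ (n : ℤ) (x : C.X n), f (n + 1) (C.d n x) = D.d n (f n x)

lemma ChainMap.f_chom {C D : CochainCpx} (ψ : ChainMap C D) {i j : ℤ} (h : i = j)
    (x : C.X i) : ψ.f j (chom C.X h x) = chom D.X h (ψ.f i x) := by subst h; rfl

/-- Composition of chain maps. -/
def ChainMap.comp {C D E : CochainCpx} (g : ChainMap D E) (f : ChainMap C D) :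
    ChainMap C E where
  f n := (g.f n).comp (f.f n)
  comm n x := by simp [ChainMap.comm]

/-- The subgroup of cocycles in degree `k`. -/
abbrev cocycles (C : CochainCpx) (k : ℤ) : AddSubgroup (C.X k) := (C.d k).ker

/-- The subgroup of coboundaries in degree `k`. -/
abbrev coboundaries (C : CochainCpx) (k : ℤ) : AddSubgroup (C.X k) :=
  ((chom C.X (show k - 1 + 1 = k by omega)).comp (C.d (k - 1))).range

lemma coboundaries_le_cocycles (C : CochainCpx) (k : ℤ) :
    coboundaries C k ≤ cocycles C k := by
  rintro x ⟨y, rfl⟩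
  simp only [AddMonoidHom.mem_ker, AddMonoidHom.comp_apply]
  rw [C.d_chom, C.dsq]
  simp

/-- The `k`-th cohomology group of a cochain complex. -/
abbrev cohomology (C : CochainCpx) (k : ℤ) :=
  cocycles C k ⧸ ((coboundaries C k).addSubgroupOf (cocycles C k))

/-- The cohomology class of a cocycle. -/
def cls (C : CochainCpx) (k : ℤ) (x : C.X k) (hx : C.d k x = 0) : cohomology C k :=
  QuotientAddGroup.mk ⟨x, hx⟩

/-- The map induced on cocycles by a chain map. -/
def cocycleMap {C D : CochainCpx} (ψ : ChainMap C D) (k : ℤ) :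
    cocycles C k →+ cocycles D k :=
  AddMonoidHom.codRestrict ((ψ.f k).comp (cocycles C k).subtype) _ fun x => by
    have hx : C.d k x.1 = 0 := x.2
    simp [AddMonoidHom.mem_ker, ← ψ.comm, hx]

lemma map_coboundaries {C D : CochainCpx} (ψ : ChainMap C D) (k : ℤ)
    {x : C.X k} (hx : x ∈ coboundaries C k) : ψ.f k x ∈ coboundaries D k := by
  obtain ⟨y, rfl⟩ := hx
  refine ⟨ψ.f (k - 1) y, ?_⟩
  rw [AddMonoidHom.comp_apply, AddMonoidHom.comp_apply, ← ψ.comm, ← ψ.f_chom]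

/-- The map induced on cohomology by a chain map. -/
def Hmap {C D : CochainCpx} (ψ : ChainMap C D) (k : ℤ) :
    cohomology C k →+ cohomology D k :=
  QuotientAddGroup.map _ _ (cocycleMap ψ k) (by
    intro x hx
    rw [AddSubgroup.mem_addSubgroupOf] at hx
    rw [AddSubgroup.mem_comap, AddSubgroup.mem_addSubgroupOf]
    exact map_coboundaries ψ k hx)

/-- Degreewise direct sum of two cochain complexes. -/
def dirSum (L F : CochainCpx) : CochainCpx where
  X n := L.X n × F.X n
  grp n := inferInstance
  d n := ((L.d n).comp (AddMonoidHom.fst _ _)).prod ((F.d n).comp (AddMonoidHom.snd _ _))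
  dsq n x := by
    show (L.d (n+1) (L.d n x.1), F.d (n+1) (F.d n x.2)) = 0
    rw [L.dsq, F.dsq]
    rfl

/-- The chain map `L ⊕ F → D`, `(l, f) ↦ i(l) + φ(f)`. -/
def pairMap {L F D : CochainCpx} (i : ChainMap L D) (φ : ChainMap F D) :
    ChainMap (dirSum L F) D where
  f n := ((i.f n).comp (AddMonoidHom.fst _ _)) + ((φ.f n).comp (AddMonoidHom.snd _ _))
  comm n x := by
    show i.f (n+1) ((L.d n) x.1) + φ.f (n+1) ((F.d n) x.2)
      = (D.d n) (i.f n x.1 + φ.f n x.2)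
    rw [map_add, i.comm, φ.comm]

/-- The mapping cone of a chain map `ψ : A → B`, with `cone(ψ)^m = A^m ⊕ B^{m-1}` and
differential `d(x, y) = (d x, ψ(x) − d y)`. -/
def cone {A B : CochainCpx} (ψ : ChainMap A B) : CochainCpx where
  X m := A.X m × B.X (m - 1)
  grp m := inferInstance
  d m := ((A.d m).comp (AddMonoidHom.fst _ _)).prod
      (((chom B.X (show m = m + 1 - 1 by omega)).comp
          ((ψ.f m).comp (AddMonoidHom.fst _ _))) -
       ((chom B.X (show m - 1 + 1 = m + 1 - 1 by omega)).comp
          ((B.d (m - 1)).comp (AddMonoidHom.snd _ _))))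
  dsq m x := by
    simp only [AddMonoidHom.prod_apply, AddMonoidHom.comp_apply, AddMonoidHom.coe_fst,
      AddMonoidHom.coe_snd, AddMonoidHom.sub_apply, map_sub]
    rw [A.dsq, ψ.comm, B.d_chom, B.d_chom, chom_chom, chom_chom]
    rw [show B.d (m - 1 + 1) ((B.d (m-1)) x.2) = 0 from B.dsq _ _]
    simp only [map_zero, sub_zero]
    rw [sub_self]
    rfl

/-- The degreewise kernel of a chain map, as a subcomplex. -/
def kerCpx {A B : CochainCpx} (ψ : ChainMap A B) : CochainCpx where
  X n := (ψ.f n).ker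
  grp n := inferInstance
  d n := AddMonoidHom.codRestrict ((A.d n).comp (ψ.f n).ker.subtype) _ fun x => by
    have hx : ψ.f n x.1 = 0 := x.2
    simp [AddMonoidHom.mem_ker, AddMonoidHom.comp_apply, ψ.comm, hx]
  dsq n x := Subtype.ext (by
    show A.d (n+1) (A.d n x.1) = 0
    exact A.dsq n x.1)

/-- The degreewise cokernel of a chain map, as a quotient complex. -/
def cokerCpx {A B : CochainCpx} (ψ : ChainMap A B) : CochainCpx where
  X n := B.X n ⧸ (ψ.f n).range
  grp n := inferInstance
  d n := QuotientAddGroup.map _ _ (B.d n) (by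
    rintro x ⟨a, rfl⟩
    exact ⟨A.d n a, ψ.comm n a⟩)
  dsq n x := by
    induction x using QuotientAddGroup.induction_on with
    | H b =>
      show QuotientAddGroup.map _ _ _ _ (QuotientAddGroup.map _ _ _ _ ((QuotientAddGroup.mk b))) = 0
      rw [QuotientAddGroup.map_mk, QuotientAddGroup.map_mk, B.dsq]
      rfl

/-- The degreewise quotient chain map onto the cokernel complex. -/
def cokerProj {A B : CochainCpx} (ψ : ChainMap A B) : ChainMap B (cokerCpx ψ) where
  f n := QuotientAddGroup.mk' (ψ.f n).range
  comm _ _ := rfl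

/-- The subgroup underlying the brutal truncation `σ_{≥k}` in degree `n`. -/
def truncSub (F : CochainCpx) (k n : ℤ) : AddSubgroup (F.X n) where
  carrier := {x | n < k → x = 0}
  zero_mem' := fun _ => rfl
  add_mem' := by
    intro a b ha hb
    intro h
    show a + b = 0
    rw [ha h, hb h, add_zero]
  neg_mem' := by
    intro a ha h
    show -a = 0
    rw [ha h, neg_zero]

/-- The brutal truncation `σ_{≥k}F`: equal to `F` in degrees `≥ k`, zero below. -/
def truncGE (F : CochainCpx) (k : ℤ) : CochainCpx where
  X n := truncSub F k n
  grp n := inferInstance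
  d n := AddMonoidHom.codRestrict ((F.d n).comp (truncSub F k n).subtype) _ fun x => by
    intro h
    show F.d n x.1 = 0
    rw [x.2 (by omega), map_zero]
  dsq n x := Subtype.ext (by
    show F.d (n+1) (F.d n x.1) = 0
    exact F.dsq n x.1)

/-- The inclusion `σ_{≥k}F ↪ F`. -/
def truncGEIncl (F : CochainCpx) (k : ℤ) : ChainMap (truncGE F k) F where
  f n := (truncSub F k n).subtype
  comm _ _ := rfl

/-- The subgroup underlying the brutal truncation `σ_{<k}` in degree `n`. -/
def truncLTSub (F : CochainCpx) (k n : ℤ) : AddSubgroup (F.X n) where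
  carrier := {x | k ≤ n → x = 0}
  zero_mem' := fun _ => rfl
  add_mem' := by
    intro a b ha hb h
    show a + b = 0
    rw [ha h, hb h, add_zero]
  neg_mem' := by
    intro a ha h
    show -a = 0
    rw [ha h, neg_zero]

/-- The brutal truncation `σ_{<k}F`: equal to `F` in degrees `< k`, zero in degrees `≥ k`. -/
def truncLT (F : CochainCpx) (k : ℤ) : CochainCpx where
  X n := truncLTSub F k n
  grp n := inferInstance
  d n :=
    { toFun := fun x => if h : k ≤ n + 1 then 0 else ⟨F.d n x.1, fun hk => absurd hk h⟩
      map_zero' := by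
        split
        · rfl
        · exact Subtype.ext (by simp)
      map_add' := fun a b => by
        split
        · simp
        · exact Subtype.ext (by
            show F.d n (a.1 + b.1) = F.d n a.1 + F.d n b.1
            rw [map_add]) }
  dsq n x := by
    show (if h : k ≤ n + 1 + 1 then 0 else _) = 0
    split
    · rfl
    · next h =>
      have h1 : ¬ k ≤ n + 1 := by omega
      refine Subtype.ext ?_
      show F.d (n + 1) (↑(if h : k ≤ n + 1 then (0 : truncLTSub F k (n+1)) else ⟨F.d n x.1, fun hk => absurd hk h⟩)) = 0
      rw [dif_neg h1]
      exact F.dsq n x.1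

lemma chom_injective (T : ℤ → Type) [∀ n, AddCommGroup (T n)] {i j : ℤ} (h : i = j) :
    Function.Injective (chom T h) := by
  subst h
  exact fun _ _ hxy => hxy

lemma chom_cone {A B : CochainCpx} (ψ : ChainMap A B) {i j : ℤ} (h : i = j)
    (x : (cone ψ).X i) :
    chom (cone ψ).X h x = (chom A.X h x.1, chom B.X (by rw [h]) x.2) := by
  subst h; rfl

lemma chom_dirSum (A B : CochainCpx) {i j : ℤ} (h : i = j) (x : (dirSum A B).X i) :
    chom (dirSum A B).X h x = (chom A.X h x.1, chom B.X h x.2) := by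
  subst h; rfl

lemma cone_d_apply {A B : CochainCpx} (ψ : ChainMap A B) (m : ℤ) (x : (cone ψ).X m) :
    (cone ψ).d m x = (A.d m x.1,
      chom B.X (show m = m + 1 - 1 by omega) (ψ.f m x.1) -
        chom B.X (show m - 1 + 1 = m + 1 - 1 by omega) (B.d (m - 1) x.2)) := rfl

/-- A pair is a cocycle of the cone iff its first entry is a cocycle whose image is the
differential of the second entry. -/
lemma cone_d_eq_zero_iff {A B : CochainCpx} (ψ : ChainMap A B) (m : ℤ) (x : (cone ψ).X m) :
    (cone ψ).d m x = 0 ↔ A.d m x.1 = 0 ∧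
      ψ.f m x.1 = chom B.X (show m - 1 + 1 = m by omega) (B.d (m - 1) x.2) := by
  have hc : chom B.X (show m - 1 + 1 = m + 1 - 1 by omega) (B.d (m - 1) x.2) =
      chom B.X (show m = m + 1 - 1 by omega)
        (chom B.X (show m - 1 + 1 = m by omega) (B.d (m - 1) x.2)) := by rw [chom_chom]
  rw [cone_d_apply, hc]
  refine Prod.mk_eq_zero.trans (and_congr_right fun _ => ?_)
  rw [sub_eq_zero, (chom_injective B.X _).eq_iff]

/-- A pair is a coboundary of the cone iff it is the cone differential of some pair. -/
lemma mem_coboundaries_cone_iff {A B : CochainCpx} (ψ : ChainMap A B) (m : ℤ)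
    (x : (cone ψ).X m) :
    x ∈ coboundaries (cone ψ) m ↔ ∃ (a : A.X (m - 1)) (b : B.X (m - 1 - 1)),
      x.1 = chom A.X (show m - 1 + 1 = m by omega) (A.d (m - 1) a) ∧
      x.2 = ψ.f (m - 1) a -
        chom B.X (show m - 1 - 1 + 1 = m - 1 by omega) (B.d (m - 1 - 1) b) := by
  have key : ∀ y : (cone ψ).X (m - 1),
      chom (cone ψ).X (show m - 1 + 1 = m by omega) ((cone ψ).d (m - 1) y) =
        (chom A.X (show m - 1 + 1 = m by omega) (A.d (m - 1) y.1),
          ψ.f (m - 1) y.1 -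
            chom B.X (show m - 1 - 1 + 1 = m - 1 by omega) (B.d (m - 1 - 1) y.2)) := by
    intro y
    rw [chom_cone, cone_d_apply]
    simp only [map_sub, chom_chom, chom_rfl]
    rfl
  constructor
  · rintro ⟨y, rfl⟩
    exact ⟨y.1, y.2, congrArg Prod.fst (key y), congrArg Prod.snd (key y)⟩
  · rintro ⟨a, b, ha, hb⟩
    exact ⟨(a, b), (key (a, b)).trans (Prod.ext ha.symm hb.symm)⟩

/-- The chain map `cone (L ⊕ F → D) → cone (F → E)`, `((l, f), v) ↦ (f, p v)`, for
`p ∘ i = 0`. -/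
def conePairMap {L D E F : CochainCpx} (i : ChainMap L D) (p : ChainMap D E)
    (hpi : ∀ (n : ℤ) (l : L.X n), p.f n (i.f n l) = 0) (φ : ChainMap F D) :
    ChainMap (cone (pairMap i φ)) (cone (p.comp φ)) where
  f m := ((AddMonoidHom.snd (L.X m) (F.X m)).comp (AddMonoidHom.fst _ _)).prod
    ((p.f (m - 1)).comp (AddMonoidHom.snd _ _))
  comm m x := by
    refine Prod.ext rfl ?_
    change p.f (m + 1 - 1) (chom D.X _ (i.f m x.1.1 + φ.f m x.1.2) -
        chom D.X _ (D.d (m - 1) x.2)) =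
      chom E.X _ (p.f m (φ.f m x.1.2)) - chom E.X _ (E.d (m - 1) (p.f (m - 1) x.2))
    rw [map_sub, p.f_chom, p.f_chom, map_add, hpi, zero_add, p.comm]

lemma Hmap_injective_of {C D : CochainCpx} (ψ : ChainMap C D) (k : ℤ)
    (h : ∀ x : C.X k, C.d k x = 0 → ψ.f k x ∈ coboundaries D k → x ∈ coboundaries C k) :
    Function.Injective (Hmap ψ k) := by
  rw [injective_iff_map_eq_zero]
  intro x
  induction x using QuotientAddGroup.induction_on with
  | H x =>
    intro hx
    have hx' := (QuotientAddGroup.eq_zero_iff (cocycleMap ψ k x)).1 hx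
    exact (QuotientAddGroup.eq_zero_iff x).2 (h x.1 x.2 hx')

lemma Hmap_surjective_of {C D : CochainCpx} (ψ : ChainMap C D) (k : ℤ)
    (h : ∀ y : D.X k, D.d k y = 0 → ∃ x : C.X k, C.d k x = 0 ∧ ψ.f k x = y) :
    Function.Surjective (Hmap ψ k) := by
  intro y
  induction y using QuotientAddGroup.induction_on with
  | H y =>
    obtain ⟨x, hx, hxy⟩ := h y.1 y.2
    exact ⟨QuotientAddGroup.mk ⟨x, hx⟩, congrArg QuotientAddGroup.mk (Subtype.ext hxy)⟩

section

variable {L D E F : CochainCpx} (i : ChainMap L D) (p : ChainMap D E)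
  (hpi : ∀ (n : ℤ) (l : L.X n), p.f n (i.f n l) = 0) (φ : ChainMap F D)

lemma conePairMap_surjective_cocycles
    (hi : ∀ n : ℤ, Function.Injective (i.f n)) (hp : ∀ n : ℤ, Function.Surjective (p.f n))
    (hex : ∀ n : ℤ, (i.f n).range = (p.f n).ker) (k : ℤ)
    (y : (cone (p.comp φ)).X k) (hy : (cone (p.comp φ)).d k y = 0) :
    ∃ x : (cone (pairMap i φ)).X k,
      (cone (pairMap i φ)).d k x = 0 ∧ (conePairMap i p hpi φ).f k x = y := by
  obtain ⟨f, e⟩ := y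
  obtain ⟨hf, hfe⟩ := (cone_d_eq_zero_iff _ _ _).1 hy
  obtain ⟨v, rfl⟩ := hp _ e
  change F.d k f = 0 at hf
  change p.f k (φ.f k f) = chom E.X _ (E.d (k - 1) (p.f (k - 1) v)) at hfe
  have hker : chom D.X (show k - 1 + 1 = k by omega) (D.d (k - 1) v) - φ.f k f ∈
      (p.f k).ker := by
    rw [AddMonoidHom.mem_ker, map_sub, p.f_chom, p.comm, hfe, sub_self]
  rw [← hex] at hker
  obtain ⟨l, hl⟩ := hker
  have hdl : L.d k l = 0 := by
    apply hi
    rw [i.comm, hl, map_sub, D.d_chom, D.dsq, ← φ.comm, hf]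
    simp
  refine ⟨((l, f), v), (cone_d_eq_zero_iff _ _ _).2 ⟨Prod.ext hdl hf, ?_⟩, rfl⟩
  change i.f k l + φ.f k f = _
  rw [hl, sub_add_cancel]

lemma mem_coboundaries_of_conePairMap
    (hi : ∀ n : ℤ, Function.Injective (i.f n)) (hp : ∀ n : ℤ, Function.Surjective (p.f n))
    (hex : ∀ n : ℤ, (i.f n).range = (p.f n).ker) (k : ℤ)
    (x : (cone (pairMap i φ)).X k) (hx : (cone (pairMap i φ)).d k x = 0)
    (hQ : (conePairMap i p hpi φ).f k x ∈ coboundaries (cone (p.comp φ)) k) :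
    x ∈ coboundaries (cone (pairMap i φ)) k := by
  obtain ⟨⟨l, f⟩, v⟩ := x
  obtain ⟨-, hv⟩ := (cone_d_eq_zero_iff _ _ _).1 hx
  obtain ⟨f', e', hf, he⟩ := (mem_coboundaries_cone_iff _ _ _).1 hQ
  obtain ⟨v', rfl⟩ := hp _ e'
  change i.f k l + φ.f k f = chom D.X _ (D.d (k - 1) v) at hv
  change f = _ at hf
  change p.f (k - 1) v = p.f (k - 1) (φ.f (k - 1) f') - _ at he
  have hker : v - φ.f (k - 1) f' +
      chom D.X (show k - 1 - 1 + 1 = k - 1 by omega) (D.d (k - 1 - 1) v') ∈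
      (p.f (k - 1)).ker := by
    rw [AddMonoidHom.mem_ker, map_add, map_sub, p.f_chom, p.comm, he]
    abel
  rw [← hex] at hker
  obtain ⟨l', hl'⟩ := hker
  have hl : l = chom L.X (show k - 1 + 1 = k by omega) (L.d (k - 1) l') := by
    apply hi
    rw [i.f_chom, i.comm, hl', map_add, map_sub, D.d_chom, D.dsq, map_zero, add_zero,
      map_sub, ← hv, ← φ.comm, ← φ.f_chom, ← hf, add_sub_cancel_right]
  refine (mem_coboundaries_cone_iff _ _ _).2 ⟨(l', f'), v', ?_, ?_⟩
  · rw [chom_dirSum]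
    exact Prod.ext hl hf
  · change v = i.f (k - 1) l' + φ.f (k - 1) f' - _
    rw [hl']
    abel

end

/-- **Corollary 2.5.** Given a degreewise short exact sequence
`0 → L →(i)→ D →(p)→ E → 0` of ℤ-indexed cochain complexes of abelian groups, a chain
map `φ : F → D`, and `k : ℤ` with `F^j = 0` for all `j < k`, the natural map
`H^k(cone(p∘φ : F → E)) → H^k(cone((i,φ) : L ⊕ F → D))` is an isomorphism of abelian
groups: it is the inverse of the map on `H^k` induced by the natural chain map
`Q : cone(L ⊕ F → D) → cone(F → E)`, `(l, f, v) ↦ (f, p(v))`. -/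
theorem differential_characters_iso_multiplicative_cohomology
    (L D E F : CochainCpx) (i : ChainMap L D) (p : ChainMap D E)
    (hi : ∀ n : ℤ, Function.Injective (i.f n))
    (hp : ∀ n : ℤ, Function.Surjective (p.f n))
    (hex : ∀ n : ℤ, (i.f n).range = (p.f n).ker)
    (φ : ChainMap F D) (k : ℤ)
    (hF : ∀ j : ℤ, j < k → ∀ x : F.X j, x = 0) :
    ∃ Q : ChainMap (cone (pairMap i φ)) (cone (p.comp φ)),
      (∀ (m : ℤ) (l : L.X m) (f : F.X m) (v : D.X (m - 1)),
        Q.f m ((l, f), v) = (f, p.f (m - 1) v)) ∧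
      ∃ e : cohomology (cone (p.comp φ)) k ≃+ cohomology (cone (pairMap i φ)) k,
        ∀ x : cohomology (cone (pairMap i φ)) k, e (Hmap Q k x) = x := by
  have hpi : ∀ (n : ℤ) (l : L.X n), p.f n (i.f n l) = 0 := fun n l =>
    (hex n).le ⟨l, rfl⟩
  have hbij : Function.Bijective (Hmap (conePairMap i p hpi φ) k) :=
    ⟨Hmap_injective_of _ k (mem_coboundaries_of_conePairMap i p hpi φ hi hp hex k),
      Hmap_surjective_of _ k (conePairMap_surjective_cocycles i p hpi φ hi hp hex k)⟩
  exact ⟨conePairMap i p hpi φ, fun _ _ _ _ => rfl,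
    (AddEquiv.ofBijective _ hbij).symm, (AddEquiv.ofBijective _ hbij).symm_apply_apply⟩
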